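/- arXiv:1307.4554 — 6 statements merged into one kernel-verified Lean document; each statement's English description precedes it below -/
import Mathlib

section
/- For all real numbers r and s, the integral over x from -infinity to infinity of the (absolutely convergent) double series sum over m from 0 to infinity and n from 0 to infinity of H_m(x) * H_n(x) * r^m * s^n * e^{-x^2} / (m! * n!) equals sqrt(pi) * e^{2*r*s}. -/
open MeasureTheory Real

/-- The physicists' Hermite polynomials, defined by their three-term recurrence. -/
noncomputable def hermiteH : ℕ → ℝ → ℝ
  | 0, _ => 1
  | 1, x => 2 * x
  | (n + 2), x => 2 * x * hermiteH (n + 1) x - 2 * (n + 1) * hermiteH n x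

lemma gen_iter (x : ℝ) (n : ℕ) (z : ℂ) :
    iteratedDeriv (n + 2) (fun z : ℂ => Complex.exp (2 * x * z - z ^ 2)) z =
      (2 * x - 2 * z) * iteratedDeriv (n + 1) (fun z : ℂ => Complex.exp (2 * x * z - z ^ 2)) z
      - 2 * (n + 1) * iteratedDeriv n (fun z : ℂ => Complex.exp (2 * x * z - z ^ 2)) z := by
  set f := (fun z : ℂ => Complex.exp (2 * x * z - z ^ 2)) with hf
  have hcd : ContDiff ℂ ⊤ f := by rw [hf]; fun_prop
  have hd : ∀ n z, HasDerivAt (iteratedDeriv n f) (iteratedDeriv (n + 1) f z) z := by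
    intro n z
    rw [iteratedDeriv_succ]
    exact (hcd.differentiable_iteratedDeriv n (by exact_mod_cast WithTop.coe_lt_top _) z).hasDerivAt
  have hlin : ∀ z : ℂ, HasDerivAt (fun z : ℂ => 2 * (x : ℂ) - 2 * z) (-2) z := by
    intro z
    simpa using ((hasDerivAt_id z).const_mul (2 : ℂ)).const_sub (2 * (x : ℂ))
  have h1 : iteratedDeriv 1 f = fun z => (2 * x - 2 * z) * f z := by
    funext z
    rw [iteratedDeriv_one]
    have : HasDerivAt f (Complex.exp (2 * x * z - z ^ 2) * (2 * x * 1 - 2 * z)) z := by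
      refine HasDerivAt.cexp (HasDerivAt.sub ((hasDerivAt_id z).const_mul _) ?_)
      simpa using hasDerivAt_pow 2 z
    rw [this.deriv, hf]; ring
  induction n generalizing z with
  | zero =>
    have h := hd 1 z
    have h0 := hd 0 z
    rw [iteratedDeriv_zero] at h0
    have h2 := (hlin z).mul h0
    have h' := h
    rw [h1] at h'
    have := h'.unique h2
    simp only [zero_add, Nat.cast_zero, iteratedDeriv_zero] at *
    rw [show 1 + 1 = 2 from rfl] at this
    rw [this]; ring
  | succ n ih =>
    have h := hd (n + 2) z
    have h2 := ((hlin z).mul (hd (n + 1) z)).sub ((hd n z).const_mul (2 * ((n : ℂ) + 1)))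
    have e : iteratedDeriv (n + 2) f = (fun z => (2 * (x : ℂ) - 2 * z)) * iteratedDeriv (n + 1) f
        - fun z => 2 * ((n : ℂ) + 1) * iteratedDeriv n f z := by
      funext z; exact ih z
    rw [e] at h
    have := h.unique h2
    rw [show n + 1 + 2 = n + 2 + 1 from rfl, this, show n + 1 + 1 = n + 2 from rfl]
    push_cast; ring

lemma gen_coeff (x : ℝ) (n : ℕ) :
    iteratedDeriv n (fun z : ℂ => Complex.exp (2 * x * z - z ^ 2)) 0 = (hermiteH n x : ℂ) := by
  induction n using Nat.twoStepInduction with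
  | zero => simp [hermiteH]
  | one =>
    rw [iteratedDeriv_one]
    have : HasDerivAt (fun z : ℂ => Complex.exp (2 * x * z - z ^ 2))
        (Complex.exp (2 * x * 0 - 0 ^ 2) * (2 * x * 1 - 2 * 0)) 0 := by
      refine HasDerivAt.cexp (HasDerivAt.sub ((hasDerivAt_id (0 : ℂ)).const_mul _) ?_)
      simpa using hasDerivAt_pow 2 (0 : ℂ)
    rw [this.deriv]; simp [hermiteH]
  | more n h0 h1 =>
    rw [gen_iter, h0, h1, hermiteH]; push_cast; ring

lemma gen_hasSum (x t : ℝ) :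
    HasSum (fun n : ℕ => hermiteH n x * t ^ n / n.factorial) (Real.exp (2 * x * t - t ^ 2)) := by
  have hd : Differentiable ℂ (fun z : ℂ => Complex.exp (2 * x * z - z ^ 2)) := by fun_prop
  have h := Complex.hasSum_taylorSeries_of_entire hd 0 (t : ℂ)
  simp only [gen_coeff, sub_zero, smul_eq_mul] at h
  rw [← Complex.hasSum_ofReal]
  convert! h using 1
  · funext n; push_cast; field_simp
  · push_cast; rfl

/-- The Mehler-type integral
`∫_{-∞}^∞ ∑_{m,n≥0} H_m(x) H_n(x) r^m s^n e^{-x²} / (m! n!) dx = √π e^{2rs}`. -/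
theorem integral_hermite_double_series (r s : ℝ) :
    ∫ x : ℝ, ∑' p : ℕ × ℕ,
        hermiteH p.1 x * hermiteH p.2 x * r ^ p.1 * s ^ p.2 * Real.exp (-x ^ 2) /
          (p.1.factorial * p.2.factorial) =
      Real.sqrt π * Real.exp (2 * r * s) := by
  have key : ∀ x : ℝ, ∑' p : ℕ × ℕ,
        hermiteH p.1 x * hermiteH p.2 x * r ^ p.1 * s ^ p.2 * Real.exp (-x ^ 2) /
          (p.1.factorial * p.2.factorial) =
      Real.exp (-1 * (x - (r + s)) ^ 2) * Real.exp (2 * r * s) := by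
    intro x
    have hr := gen_hasSum x r
    have hs := gen_hasSum x s
    have h := tsum_mul_tsum_of_summable_norm hr.summable.norm hs.summable.norm
    rw [hr.tsum_eq, hs.tsum_eq] at h
    calc _ = ∑' p : ℕ × ℕ, (hermiteH p.1 x * r ^ p.1 / p.1.factorial *
          (hermiteH p.2 x * s ^ p.2 / p.2.factorial)) * Real.exp (-x ^ 2) := by
          refine tsum_congr fun p => ?_
          field_simp
      _ = _ := by
          rw [tsum_mul_right, ← h, ← Real.exp_add, ← Real.exp_add, ← Real.exp_add]
          congr 1; ring
  simp_rw [key]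
  rw [integral_mul_const,
    integral_sub_right_eq_self (fun x : ℝ => Real.exp (-1 * x ^ 2)) (r + s), integral_gaussian]
  simp
end

section
/- For every natural number n >= 1 and every real number y, the integral over x from -1 to 1 of (1-x^2)^{-1/2} * T_n(1 - x^2*y) dx equals (pi/2) * (P_{n-1}(1-y) + P_n(1-y)). -/
open MeasureTheory Real intervalIntegral

/-- The Legendre polynomial `P_n(x)`, defined by the Rodrigues formula. -/
noncomputable def legendreP (n : ℕ) (x : ℝ) : ℝ :=
  (1 / (2 ^ n * n.factorial)) * iteratedDeriv n (fun t : ℝ => (t ^ 2 - 1) ^ n) x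

theorem aux_choose_down (n k : ℕ) :
    ((n.choose (k + 1) : ℕ) : ℝ) * (k + 1) = n.choose k * ((n : ℝ) - k) := by
  rcases le_or_gt k n with h | h
  · have := Nat.choose_succ_right_eq n k
    rw [← Nat.cast_sub h]
    exact_mod_cast this
  · rw [Nat.choose_eq_zero_of_lt h, Nat.choose_eq_zero_of_lt (by omega)]
    simp

theorem aux_choose_up (n k : ℕ) :
    (((n + (k + 1)).choose n : ℕ) : ℝ) * (k + 1) = (n + k).choose n * ((n : ℝ) + k + 1) := by
  have h := Nat.add_one_mul_choose_eq (n + k) k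
  have h1 : (n + (k + 1)).choose n = (n + k + 1).choose (k + 1) := Nat.choose_symm_add
  have h2 : (n + k).choose n = (n + k).choose k := Nat.choose_symm_add
  rw [h1, h2]
  have h' : ((n : ℝ) + k + 1) * ((n + k).choose k : ℕ)
      = ((n + k + 1).choose (k + 1) : ℕ) * ((k : ℝ) + 1) := by exact_mod_cast h
  linarith

theorem aux_A (n k : ℕ) :
    ((k.factorial : ℝ)) ^ 2 * ((n.choose k : ℕ) * ((n + k).choose n : ℕ)) =
      ∏ l ∈ Finset.range k, ((n : ℝ) - l) * (n + l + 1) := by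
  induction k with
  | zero => simp
  | succ k ih =>
    rw [Finset.prod_range_succ, ← ih, Nat.factorial_succ]
    push_cast
    have h1 := aux_choose_down n k
    have h2 := aux_choose_up n k
    calc _ = (k.factorial : ℝ) ^ 2 * ((((n.choose (k + 1) : ℕ) : ℝ) * (k + 1)) *
          ((((n + (k + 1)).choose n : ℕ) : ℝ) * (k + 1))) := by ring
      _ = _ := by rw [h1, h2]; ring

theorem aux_A1 (n : ℝ) (k : ℕ) :
    n * ∏ l ∈ Finset.range k, (n - l) * (n + l + 1) =
      (n + k) * ∏ l ∈ Finset.range k, (n ^ 2 - (l : ℝ) ^ 2) := by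
  induction k with
  | zero => simp
  | succ k ih =>
    rw [Finset.prod_range_succ, Finset.prod_range_succ, ← mul_assoc, ih]
    push_cast
    ring

theorem aux_B1 (n : ℝ) (k : ℕ) :
    (n + 1) * ∏ l ∈ Finset.range k, (n - l) * (n + l + 1) =
      (n + 1 - k) * ∏ l ∈ Finset.range k, ((n + 1) ^ 2 - (l : ℝ) ^ 2) := by
  induction k with
  | zero => simp
  | succ k ih =>
    rw [Finset.prod_range_succ, Finset.prod_range_succ, ← mul_assoc, ih]
    push_cast
    ring

theorem aux_comb (m k : ℕ) :
    2 * ∏ l ∈ Finset.range k, (((m : ℝ) + 1) ^ 2 - (l : ℝ) ^ 2) =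
      ((k.factorial : ℝ)) ^ 2 * ((m.choose k : ℕ) * ((m + k).choose m : ℕ) +
        ((m + 1).choose k : ℕ) * ((m + 1 + k).choose (m + 1) : ℕ)) := by
  rw [mul_add, aux_A, aux_A]
  have h0 : ((m : ℝ) + 1) ≠ 0 := by positivity
  have h1 := aux_A1 ((m : ℝ) + 1) k
  have h2 := aux_B1 (m : ℝ) k
  apply mul_left_cancel₀ h0
  push_cast
  linear_combination -h1 - h2

theorem aux_legendre (n : ℕ) (y : ℝ) :
    legendreP n (1 - y) =
      ∑ k ∈ Finset.range (n + 1),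
        (-1) ^ k * (n.choose k : ℕ) * ((n + k).choose n : ℕ) * (y / 2) ^ k := by
  have hpoly : ∀ (p : Polynomial ℝ) (k : ℕ),
      iteratedDeriv k (fun z => p.eval z) = fun z => (Polynomial.derivative^[k] p).eval z := by
    intro p k
    induction k with
    | zero => simp
    | succ k ih =>
      rw [iteratedDeriv_succ, ih, Function.iterate_succ_apply']
      funext z
      exact Polynomial.deriv _
  have hs : (Polynomial.shiftedLegendre n).aeval (y / 2) =
      ∑ k ∈ Finset.range (n + 1),
        (-1) ^ k * (n.choose k : ℕ) * ((n + k).choose n : ℕ) * (y / 2) ^ k := by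
    rw [Polynomial.aeval_eq_sum_range, Polynomial.natDegree_shiftedLegendre]
    refine Finset.sum_congr rfl fun k _ => ?_
    rw [Polynomial.coeff_shiftedLegendre]
    simp
  rw [← hs]
  have hR := congrArg (fun q => (q.map (Int.castRingHom ℝ)).eval (y / 2))
    (Polynomial.factorial_mul_shiftedLegendre_eq n)
  simp only [← Polynomial.iterate_derivative_map,
    Polynomial.map_mul, Polynomial.map_natCast, Polynomial.eval_mul, Polynomial.eval_natCast,
    Polynomial.map_pow, Polynomial.map_X, Polynomial.map_sub, Polynomial.map_one] at hR
  have hE : (Polynomial.shiftedLegendre n).aeval (y / 2) =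
      ((Polynomial.shiftedLegendre n).map (Int.castRingHom ℝ)).eval (y / 2) := by
    rw [Polynomial.eval_map, Polynomial.aeval_def]; rfl
  rw [← hE] at hR
  have hg : (fun z : ℝ => (Polynomial.C ((-4 : ℝ) ^ n) *
      (Polynomial.X ^ n * (1 - Polynomial.X) ^ n)).eval z) =
      fun z => (fun s : ℝ => ((1 + s) ^ 2 - 1) ^ n) (-2 * z) := by
    funext z
    simp only [Polynomial.eval_mul, Polynomial.eval_C, Polynomial.eval_pow, Polynomial.eval_X,
      Polynomial.eval_sub, Polynomial.eval_one]
    rw [← mul_pow, ← mul_pow]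
    ring
  have h1 := congrFun (hpoly (Polynomial.C ((-4 : ℝ) ^ n) *
      (Polynomial.X ^ n * (1 - Polynomial.X) ^ n)) n) (y / 2)
  rw [hg, iteratedDeriv_comp_const_mul (f := fun s : ℝ => ((1 + s) ^ 2 - 1) ^ n) (by fun_prop) (-2)] at h1
  have h2 := congrFun (iteratedDeriv_comp_const_add n (fun t : ℝ => (t ^ 2 - 1) ^ n) 1) (-2 * (y / 2))
  simp only [] at h1 h2
  rw [h2, Polynomial.iterate_derivative_C_mul, Polynomial.eval_mul, Polynomial.eval_C, ← hR] at h1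
  have h3 : (1 : ℝ) + -2 * (y / 2) = 1 - y := by ring
  rw [h3, show (-4 : ℝ) ^ n = (-2) ^ n * 2 ^ n by rw [← mul_pow]; norm_num, mul_assoc] at h1
  have h4 := mul_left_cancel₀ (pow_ne_zero n (by norm_num)) h1
  have hf : (n.factorial : ℝ) ≠ 0 := by positivity
  rw [legendreP, h4]
  field_simp

theorem aux_cos (k : ℕ) :
    ∫ θ in (0 : ℝ)..π, cos θ ^ (2 * k) =
      π * ∏ i ∈ Finset.range k, (2 * (i : ℝ) + 1) / (2 * i + 2) := by
  induction k with
  | zero => simp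
  | succ k ih =>
    rw [Finset.prod_range_succ_comm, mul_left_comm, ← ih, Nat.mul_succ, integral_cos_pow]
    simp

theorem aux_T (n : ℕ) (u : ℝ) :
    (Polynomial.Chebyshev.T ℝ n).eval (1 + u) =
      ∑ k ∈ Finset.range (n + 1),
        (∏ l ∈ Finset.range k, ((n : ℝ) ^ 2 - (l : ℝ) ^ 2)) /
          (∏ l ∈ Finset.range k, (2 * (l : ℝ) + 1)) / k.factorial * u ^ k := by
  rw [add_comm, ← Polynomial.taylor_eval, Polynomial.eval_eq_sum_range, Polynomial.natDegree_taylor,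
    Polynomial.Chebyshev.natDegree_T]
  refine Finset.sum_congr (by simp) fun k _ => ?_
  congr 1
  have hf : (k.factorial : ℝ) ≠ 0 := by positivity
  rw [Polynomial.taylor_coeff, eq_div_iff hf]
  have h := Polynomial.Chebyshev.iterate_derivative_T_eval_one_eq_div (𝔽 := ℝ) n k
  have h2 := congrFun (Polynomial.factorial_smul_hasseDeriv (R := ℝ) k) (Polynomial.Chebyshev.T ℝ n)
  rw [← h2] at h
  rw [LinearMap.smul_apply, Polynomial.eval_smul, nsmul_eq_mul] at h
  rw [mul_comm, h]
  push_cast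
  rfl

/-- `∫_{-1}^1 (1-x²)^{-1/2} T_n(1-x²y) dx = (π/2)(P_{n-1}(1-y) + P_n(1-y))`. -/
theorem integral_chebyshev_eq_legendre (n : ℕ) (hn : 1 ≤ n) (y : ℝ) :
    ∫ x in (-1 : ℝ)..1,
        (1 - x ^ 2) ^ (-(1 : ℝ) / 2) * (Polynomial.Chebyshev.T ℝ n).eval (1 - x ^ 2 * y) =
      π / 2 * (legendreP (n - 1) (1 - y) + legendreP n (1 - y)) := by
  obtain ⟨m, rfl⟩ : ∃ m, n = m + 1 := ⟨n - 1, by omega⟩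
  have hA : ∫ x in (-1 : ℝ)..1,
        (1 - x ^ 2) ^ (-(1 : ℝ) / 2) *
          (Polynomial.Chebyshev.T ℝ ((m + 1 : ℕ) : ℤ)).eval (1 - x ^ 2 * y) =
      ∫ θ in (0 : ℝ)..π,
        (Polynomial.Chebyshev.T ℝ ((m + 1 : ℕ) : ℤ)).eval (1 - cos θ ^ 2 * y) := by
    rw [← Polynomial.Chebyshev.integral_measureT_eq_integral_cos
      (f := fun x => (Polynomial.Chebyshev.T ℝ ((m + 1 : ℕ) : ℤ)).eval (1 - x ^ 2 * y)),
      Polynomial.Chebyshev.integral_measureT]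
    refine intervalIntegral.integral_congr fun x hx => ?_
    rw [Set.uIcc_of_le (by norm_num)] at hx
    have h0 : 0 ≤ 1 - x ^ 2 := by nlinarith [hx.1, hx.2]
    rw [mul_comm, neg_div, Real.rpow_neg h0, ← Real.sqrt_eq_rpow, Real.sqrt_inv]
  rw [hA]
  have hB : ∀ θ : ℝ, (Polynomial.Chebyshev.T ℝ ((m + 1 : ℕ) : ℤ)).eval (1 - cos θ ^ 2 * y) =
      ∑ k ∈ Finset.range (m + 1 + 1),
        ((∏ l ∈ Finset.range k, (((m + 1 : ℕ) : ℝ) ^ 2 - (l : ℝ) ^ 2)) /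
          (∏ l ∈ Finset.range k, (2 * (l : ℝ) + 1)) / k.factorial * (-y) ^ k) *
            cos θ ^ (2 * k) := by
    intro θ
    rw [show 1 - cos θ ^ 2 * y = 1 + (-y) * cos θ ^ 2 by ring, aux_T]
    refine Finset.sum_congr rfl fun k _ => ?_
    rw [mul_pow, ← pow_mul, mul_assoc]
  simp_rw [hB]
  rw [intervalIntegral.integral_finsetSum
    (fun k _ => (Continuous.intervalIntegrable (by fun_prop) _ _))]
  simp_rw [intervalIntegral.integral_const_mul, aux_cos]
  have hL : legendreP (m + 1 - 1) (1 - y) = ∑ k ∈ Finset.range (m + 1 + 1),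
        (-1) ^ k * (m.choose k : ℕ) * ((m + k).choose m : ℕ) * (y / 2) ^ k := by
    rw [Nat.add_sub_cancel, aux_legendre, Finset.sum_range_succ _ (m + 1)]
    simp
  rw [hL, aux_legendre, ← Finset.sum_add_distrib, Finset.mul_sum]
  refine Finset.sum_congr rfl fun k _ => ?_
  have h2 : ∏ i ∈ Finset.range k, (2 * (i : ℝ) + 2) = 2 ^ k * k.factorial := by
    induction k with
    | zero => simp
    | succ k ih =>
      rw [Finset.prod_range_succ, ih (by simp_all; omega), Nat.factorial_succ]
      push_cast
      ring
  have h1 : ∏ i ∈ Finset.range k, (2 * (i : ℝ) + 1) ≠ 0 :=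
    Finset.prod_ne_zero_iff.mpr fun i _ => by positivity
  have hf : (k.factorial : ℝ) ≠ 0 := by positivity
  have hc := aux_comb m k
  rw [Finset.prod_div_distrib, h2, div_pow, neg_pow y]
  push_cast at hc ⊢
  generalize ∏ l ∈ Finset.range k, (((m : ℝ) + 1) ^ 2 - (l : ℝ) ^ 2) = P at *
  generalize ∏ i ∈ Finset.range k, (2 * (i : ℝ) + 1) = Q at *
  have hP : P = (k.factorial : ℝ) ^ 2 * ((m.choose k : ℕ) * ((m + k).choose m : ℕ) +
        ((m + 1).choose k : ℕ) * ((m + 1 + k).choose (m + 1) : ℕ)) / 2 := by linarith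
  rw [hP]
  field_simp
end

section
/- For every natural number n, the function I(n, y) = integral over x from -1 to 1 of (1-x^2)^{-1/2} * T_n(1 - x^2*y) dx is twice differentiable in y on the real line and satisfies the ordinary differential equation (y^2 - 2y) * I_yy(n, y) + (y - 2) * I_y(n, y) - n^2 * I(n, y) = 0 for every real y. -/
open MeasureTheory Real intervalIntegral

/-- `I(n,y) = ∫_{-1}^1 (1-x²)^{-1/2} T_n(1-x²y) dx`. -/
noncomputable def chebInt (n : ℕ) (y : ℝ) : ℝ :=
  ∫ x in (-1 : ℝ)..1,
    (1 - x ^ 2) ^ (-(1 : ℝ) / 2) * (Polynomial.Chebyshev.T ℝ n).eval (1 - x ^ 2 * y)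

/-- The integral after the substitution `x = cos θ`, with an extra weight `cos^(2k)`. -/
noncomputable def chebJ (P : Polynomial ℝ) (k : ℕ) (y : ℝ) : ℝ :=
  ∫ t in (0 : ℝ)..π, (cos t ^ 2) ^ k * P.eval (1 - cos t ^ 2 * y)

theorem chebInt_eq (n : ℕ) : chebInt n = chebJ (Polynomial.Chebyshev.T ℝ n) 0 := by
  funext y
  have h1 := Polynomial.Chebyshev.integral_measureT
    (fun x => (Polynomial.Chebyshev.T ℝ n).eval (1 - x ^ 2 * y))
  have h2 := Polynomial.Chebyshev.integral_measureT_eq_integral_cos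
    (f := fun x => (Polynomial.Chebyshev.T ℝ n).eval (1 - x ^ 2 * y))
  unfold chebInt chebJ
  simp only [pow_zero, one_mul]
  rw [← h2, h1]
  apply intervalIntegral.integral_congr
  intro x hx
  rw [Set.uIcc_of_le (by norm_num)] at hx
  have h : 0 ≤ 1 - x ^ 2 := by nlinarith [hx.1, hx.2]
  have : (1 - x ^ 2) ^ (-(1 : ℝ) / 2) = √((1 - x ^ 2)⁻¹) := by
    rw [neg_div, rpow_neg h, sqrt_inv, sqrt_eq_rpow]
  simp only [this]
  ring

theorem chebJ_cont (P : Polynomial ℝ) (k : ℕ) :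
    Continuous (fun p : ℝ × ℝ => (cos p.2 ^ 2) ^ k * P.eval (1 - cos p.2 ^ 2 * p.1)) := by
  have := P.continuous
  fun_prop

theorem chebJ_cont1 (P : Polynomial ℝ) (k : ℕ) (y : ℝ) :
    Continuous (fun t : ℝ => (cos t ^ 2) ^ k * P.eval (1 - cos t ^ 2 * y)) := by
  have := P.continuous
  fun_prop

theorem chebJ_hasDerivAt (P : Polynomial ℝ) (k : ℕ) (y : ℝ) :
    HasDerivAt (chebJ P k) (-chebJ P.derivative (k + 1) y) y := by
  obtain ⟨C, hC⟩ := ((isCompact_Icc (a := y - 1) (b := y + 1)).prod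
    (isCompact_Icc (a := (0 : ℝ)) (b := π))).exists_bound_of_continuousOn
    (chebJ_cont P.derivative (k + 1)).continuousOn
  have key := intervalIntegral.hasDerivAt_integral_of_dominated_loc_of_deriv_le
    (μ := volume) (a := 0) (b := π) (x₀ := y) (s := Set.Icc (y - 1) (y + 1))
    (F := fun y t => (cos t ^ 2) ^ k * P.eval (1 - cos t ^ 2 * y))
    (F' := fun y t => -((cos t ^ 2) ^ (k + 1) * P.derivative.eval (1 - cos t ^ 2 * y)))
    (bound := fun _ => C)
    (Icc_mem_nhds (by linarith) (by linarith))
    (Filter.Eventually.of_forall fun x => (chebJ_cont1 P k x).aestronglyMeasurable)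
    ((chebJ_cont1 P k y).intervalIntegrable _ _)
    ((chebJ_cont1 P.derivative (k + 1) y).neg.aestronglyMeasurable)
    (Filter.Eventually.of_forall fun t ht x hx => by
      rw [Set.uIoc_of_le pi_pos.le] at ht
      rw [norm_neg]
      exact hC (x, t) ⟨hx, ht.1.le, ht.2⟩)
    intervalIntegrable_const
    (Filter.Eventually.of_forall fun t ht x hx => by
      have h1 : HasDerivAt (fun x : ℝ => 1 - cos t ^ 2 * x) (-(cos t ^ 2)) x := by
        simpa using ((hasDerivAt_id x).const_mul (cos t ^ 2)).const_sub 1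
      have h2 := ((P.hasDerivAt (1 - cos t ^ 2 * x)).comp x h1).const_mul ((cos t ^ 2) ^ k)
      refine h2.congr_deriv ?_
      ring)
  have h := key.2
  rw [intervalIntegral.integral_neg] at h
  exact h

theorem chebJ_ibp (Q : Polynomial ℝ) (y : ℝ) :
    ∫ t in (0 : ℝ)..π, ((2 * cos t ^ 2 - 1) * Q.eval (1 - cos t ^ 2 * y) +
      2 * y * cos t ^ 2 * (1 - cos t ^ 2) * Q.derivative.eval (1 - cos t ^ 2 * y)) = 0 := by
  have h := intervalIntegral.integral_eq_sub_of_hasDerivAt (a := 0) (b := π)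
    (f := fun t => cos t * sin t * Q.eval (1 - cos t ^ 2 * y))
    (f' := fun t => (2 * cos t ^ 2 - 1) * Q.eval (1 - cos t ^ 2 * y) +
      2 * y * cos t ^ 2 * (1 - cos t ^ 2) * Q.derivative.eval (1 - cos t ^ 2 * y))
    (fun t _ => by
      have h1 : HasDerivAt (fun t : ℝ => 1 - cos t ^ 2 * y) (2 * cos t * sin t * y) t := by
        refine ((((hasDerivAt_cos t).pow 2).mul_const y).const_sub 1).congr_deriv ?_
        push_cast
        ring
      have h2 := ((hasDerivAt_cos t).mul (hasDerivAt_sin t)).mul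
        ((Q.hasDerivAt (1 - cos t ^ 2 * y)).comp t h1)
      refine h2.congr_deriv ?_
      have hs := sin_sq t
      simp only [Function.comp_apply, Pi.mul_apply]
      linear_combination (-(Q.eval (1 - cos t ^ 2 * y)) +
        2 * y * cos t ^ 2 * Q.derivative.eval (1 - cos t ^ 2 * y)) * hs)
    (by
      have := Q.continuous
      have := Q.derivative.continuous
      exact Continuous.intervalIntegrable (by fun_prop) _ _)
  rw [h]
  simp

theorem cheb_ode_eval (n : ℕ) (u : ℝ) :
    (1 - u ^ 2) * (Polynomial.Chebyshev.T ℝ n).derivative.derivative.eval u =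
      u * (Polynomial.Chebyshev.T ℝ n).derivative.eval u -
        (n : ℝ) ^ 2 * (Polynomial.Chebyshev.T ℝ n).eval u := by
  have h := congrArg (Polynomial.eval u)
    (Polynomial.Chebyshev.one_sub_X_sq_mul_derivative_derivative_T_eq_poly_in_T (R := ℝ) n)
  simpa using h

/-- `I(n,·)` is twice differentiable and satisfies
`(y²-2y) I_yy + (y-2) I_y - n² I = 0`. -/
theorem chebInt_ode (n : ℕ) :
    Differentiable ℝ (chebInt n) ∧ Differentiable ℝ (deriv (chebInt n)) ∧
      ∀ y : ℝ,
        (y ^ 2 - 2 * y) * deriv (deriv (chebInt n)) y + (y - 2) * deriv (chebInt n) y -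
          (n : ℝ) ^ 2 * chebInt n y = 0 := by
  have hd1 : deriv (chebInt n) =
      fun y => -chebJ (Polynomial.Chebyshev.T ℝ n).derivative 1 y := by
    funext y
    rw [chebInt_eq]
    exact (chebJ_hasDerivAt _ 0 y).deriv
  have hd2 (y : ℝ) : HasDerivAt (deriv (chebInt n))
      (chebJ (Polynomial.Chebyshev.T ℝ n).derivative.derivative 2 y) y := by
    rw [hd1]
    simpa using (chebJ_hasDerivAt (Polynomial.Chebyshev.T ℝ n).derivative 1 y).fun_neg
  refine ⟨?_, fun y => (hd2 y).differentiableAt, fun y => ?_⟩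
  · rw [chebInt_eq]
    exact fun y => (chebJ_hasDerivAt _ 0 y).differentiableAt
  rw [(hd2 y).deriv, hd1, chebInt_eq]
  have hi := chebJ_ibp (Polynomial.Chebyshev.T ℝ n).derivative y
  rw [← hi]
  simp only [chebJ]
  have i0 := (chebJ_cont1 (Polynomial.Chebyshev.T ℝ n) 0 y).intervalIntegrable
    (μ := volume) 0 π
  have i1 := (chebJ_cont1 (Polynomial.Chebyshev.T ℝ n).derivative 1 y).intervalIntegrable
    (μ := volume) 0 π
  have i2 := (chebJ_cont1 (Polynomial.Chebyshev.T ℝ n).derivative.derivative 2 y).intervalIntegrable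
    (μ := volume) 0 π
  rw [mul_neg, ← sub_eq_add_neg, ← intervalIntegral.integral_const_mul,
    ← intervalIntegral.integral_const_mul, ← intervalIntegral.integral_const_mul,
    ← intervalIntegral.integral_sub (i2.const_mul _) (i1.const_mul _),
    ← intervalIntegral.integral_sub ((i2.const_mul _).sub (i1.const_mul _)) (i0.const_mul _)]
  apply intervalIntegral.integral_congr
  intro t _
  have h := cheb_ode_eval n (1 - cos t ^ 2 * y)
  simp only
  linear_combination -h
end

section
/- Let f(n, x, y) = (1-x^2)^{-1/2} * T_n(1 - x^2*y). For every natural number n, every real y, and every real x with 0 < |x| < 1, the creative telescoping identity (y^2 - 2y) * f_yy + (y - 2) * f_y - n^2 * f + d/dx[ ((x^2 - 1)/x) * f_y ] = 0 holds, where all derivatives are evaluated at (n, x, y). -/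
open Real

/-- `f(n,x,y) = (1-x²)^{-1/2} T_n(1-x²y)`. -/
noncomputable def chebF (n : ℕ) (x y : ℝ) : ℝ :=
  (1 - x ^ 2) ^ (-(1 : ℝ) / 2) * (Polynomial.Chebyshev.T ℝ n).eval (1 - x ^ 2 * y)

theorem chebF_aux_dy (n : ℕ) (x y : ℝ) :
    deriv (fun y' => chebF n x y') y = (1 - x ^ 2) ^ (-(1 : ℝ) / 2) *
      ((Polynomial.derivative (Polynomial.Chebyshev.T ℝ n)).eval (1 - x ^ 2 * y) * (-x ^ 2)) := by
  have hu : HasDerivAt (fun y' : ℝ => 1 - x ^ 2 * y') (-x ^ 2) y := by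
    simpa using ((hasDerivAt_id y).const_mul (x ^ 2)).const_sub 1
  exact ((((Polynomial.Chebyshev.T ℝ n).hasDerivAt _).comp y hu).const_mul _).deriv

/-- The creative telescoping identity
`(y²-2y) f_yy + (y-2) f_y - n² f + d/dx[((x²-1)/x) f_y] = 0`. -/
theorem chebF_creative_telescoping₂ (n : ℕ) (y x : ℝ) (hx0 : 0 < |x|) (hx1 : |x| < 1) :
    (y ^ 2 - 2 * y) * deriv (deriv (fun y' => chebF n x y')) y +
      (y - 2) * deriv (fun y' => chebF n x y') y - (n : ℝ) ^ 2 * chebF n x y +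
      deriv (fun x' => (x' ^ 2 - 1) / x' * deriv (fun y' => chebF n x' y') y) x = 0 := by
  have hpos : 0 < 1 - x ^ 2 := by
    have := (sq_lt_one_iff_abs_lt_one x).2 hx1
    linarith
  have h1 : deriv (fun y' => chebF n x y') = fun y => (1 - x ^ 2) ^ (-(1 : ℝ) / 2) *
      ((Polynomial.derivative (Polynomial.Chebyshev.T ℝ n)).eval (1 - x ^ 2 * y) * (-x ^ 2)) :=
    funext fun y => chebF_aux_dy n x y
  have hu : HasDerivAt (fun y' : ℝ => 1 - x ^ 2 * y') (-x ^ 2) y := by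
    simpa using ((hasDerivAt_id y).const_mul (x ^ 2)).const_sub 1
  have h2 := (((((Polynomial.derivative (Polynomial.Chebyshev.T ℝ n)).hasDerivAt _).comp y
    hu).mul_const (-x ^ 2)).const_mul ((1 - x ^ 2) ^ (-(1 : ℝ) / 2))).deriv
  have h3 : (fun x' => (x' ^ 2 - 1) / x' * deriv (fun y' => chebF n x' y') y) =
      fun x' => (x' - x' ^ 3) * ((1 - x' ^ 2) ^ (-(1 : ℝ) / 2) *
      (Polynomial.derivative (Polynomial.Chebyshev.T ℝ n)).eval (1 - x' ^ 2 * y)) := by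
    funext t
    rw [chebF_aux_dy]
    by_cases ht : t = 0
    · simp [ht]
    · field_simp
      ring
  have ha : HasDerivAt (fun t : ℝ => t - t ^ 3) (1 - 3 * x ^ 2) x := by
    simpa using (hasDerivAt_id' x).fun_sub (hasDerivAt_pow 3 x)
  have hb : HasDerivAt (fun t : ℝ => 1 - t ^ 2) (-(2 * x)) x := by
    simpa using (hasDerivAt_pow 2 x).const_sub 1
  have hc : HasDerivAt (fun t : ℝ => 1 - t ^ 2 * y) (-(2 * x * y)) x := by
    simpa using ((hasDerivAt_pow 2 x).mul_const y).const_sub 1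
  have h4 := (ha.mul ((hb.rpow_const (p := -(1 : ℝ) / 2) (Or.inl hpos.ne')).mul
    (((Polynomial.derivative (Polynomial.Chebyshev.T ℝ n)).hasDerivAt _).comp x hc))).deriv
  have h5 := Polynomial.Chebyshev.one_sub_X_sq_mul_derivative_derivative_T_eq_poly_in_T
    (R := ℝ) n
  replace h5 := congrArg (Polynomial.eval (1 - x ^ 2 * y)) h5
  simp at h5
  have hw : (1 - x ^ 2) ^ (-(1 : ℝ) / 2 - 1) = (1 - x ^ 2) ^ (-(1 : ℝ) / 2) / (1 - x ^ 2) :=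
    Real.rpow_sub_one hpos.ne' _
  rw [h3, h1]
  erw [h2, h4]
  have hv : (1 - x ^ 2) ^ (-(1 : ℝ) / 2 - 1) * (1 - x ^ 2) = (1 - x ^ 2) ^ (-(1 : ℝ) / 2) := by
    rw [hw, div_mul_cancel₀ _ hpos.ne']
  clear hw h1 h2 h3 h4
  simp only [chebF, Function.comp, Pi.mul_apply]
  generalize (1 - x ^ 2) ^ (-(1 : ℝ) / 2 - 1) = v at *
  generalize (1 - x ^ 2) ^ (-(1 : ℝ) / 2) = w at *
  generalize Polynomial.eval (1 - x ^ 2 * y) (Polynomial.derivative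
    (Polynomial.derivative (Polynomial.Chebyshev.T ℝ n))) = Q at *
  generalize Polynomial.eval (1 - x ^ 2 * y)
    (Polynomial.derivative (Polynomial.Chebyshev.T ℝ n)) = P at *
  generalize Polynomial.eval (1 - x ^ 2 * y) (Polynomial.Chebyshev.T ℝ n) = S at *
  linear_combination (-w) * h5 + x ^ 2 * P * hv
end

section
/- Let f(n, x, y) = (1-x^2)^{-1/2} * T_n(1 - x^2*y). For every natural number n, every real y, and every real x with 0 < |x| < 1, the creative telescoping identity (2n^2 + 2n) * f(n+1, x, y) + (2n*y^2 - 4n*y + y^2 - 2y) * f_y + (2n^2*y - 2n^2 + n*y - 2n) * f + d/dx[ (y*(x^4*y - x^2*y - 2x^2 + 2)/x) * f_y + y*(n*x^3 - n*x) * f ] = 0 holds, where all derivatives are evaluated at (n, x, y). -/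
open Real

lemma chebF_aux_deriv (n : ℕ) (x y : ℝ) :
    deriv (fun y' => chebF n x y') y = (1 - x ^ 2) ^ (-(1 : ℝ) / 2) *
      ((Polynomial.Chebyshev.T ℝ n).derivative.eval (1 - x ^ 2 * y) * (-(x ^ 2))) := by
  apply HasDerivAt.deriv
  unfold chebF
  have h1 : HasDerivAt (fun y' : ℝ => 1 - x ^ 2 * y') (-(x ^ 2)) y := by
    simpa using ((hasDerivAt_id y).const_mul (x ^ 2)).const_sub 1
  exact (((Polynomial.Chebyshev.T ℝ n).hasDerivAt (1 - x ^ 2 * y)).comp y h1).const_mul _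

theorem chebF_creative_telescoping₁ (n : ℕ) (y x : ℝ) (hx0 : 0 < |x|) (hx1 : |x| < 1) :
    (2 * (n : ℝ) ^ 2 + 2 * n) * chebF (n + 1) x y +
      (2 * n * y ^ 2 - 4 * n * y + y ^ 2 - 2 * y) * deriv (fun y' => chebF n x y') y +
      (2 * (n : ℝ) ^ 2 * y - 2 * (n : ℝ) ^ 2 + n * y - 2 * n) * chebF n x y +
      deriv (fun x' =>
        y * (x' ^ 4 * y - x' ^ 2 * y - 2 * x' ^ 2 + 2) / x' *
            deriv (fun y' => chebF n x' y') y +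
          y * ((n : ℝ) * x' ^ 3 - n * x') * chebF n x' y) x = 0 := by
  have hx : x ≠ 0 := abs_pos.mp hx0
  have hpos : 0 < 1 - x ^ 2 := by
    have := (sq_lt_one_iff_abs_lt_one x).mpr hx1
    linarith
  simp only [chebF_aux_deriv]
  unfold chebF
  set P := Polynomial.Chebyshev.T ℝ n with hP
  have hz : HasDerivAt (fun x' : ℝ => 1 - x' ^ 2 * y) (-(2 * x * y)) x := by
    simpa using ((hasDerivAt_pow 2 x).mul_const y).const_sub 1
  have hq : HasDerivAt (fun x' : ℝ => 1 - x' ^ 2) (-(2 * x)) x := by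
    simpa using (hasDerivAt_pow 2 x).const_sub 1
  have hw := hq.rpow_const (p := -(1 : ℝ) / 2) (Or.inl hpos.ne')
  have hw' : (1 - x ^ 2) ^ (-(1 : ℝ) / 2 - 1) = (1 - x ^ 2) ^ (-(1 : ℝ) / 2) / (1 - x ^ 2) := by
    rw [Real.rpow_sub_one hpos.ne']
  rw [hw'] at hw
  have hT := (P.hasDerivAt (1 - x ^ 2 * y)).comp x hz
  have hT' := (P.derivative.hasDerivAt (1 - x ^ 2 * y)).comp x hz
  -- simplified certificate: polynomial prefactors
  have hA : HasDerivAt (fun x' : ℝ => -(y * ((1 - x' ^ 2) * (x' * (1 + (1 - x' ^ 2 * y))))))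
      (-(y * (-(2 * x) * (x * (1 + (1 - x ^ 2 * y))) + (1 - x ^ 2) *
        (1 * (1 + (1 - x ^ 2 * y)) + x * (-(2 * x * y)))))) x :=
    ((hq.mul ((hasDerivAt_id' x).mul (hz.const_add 1))).const_mul y).neg
  have hB : HasDerivAt (fun x' : ℝ => -(y * n * ((1 - x' ^ 2) * x')))
      (-(y * n * (-(2 * x) * x + (1 - x ^ 2) * 1))) x :=
    ((hq.mul (hasDerivAt_id' x)).const_mul (y * n)).neg
  have hG := hw.mul ((hA.mul hT').add (hB.mul hT))
  have hev : (fun x' : ℝ => y * (x' ^ 4 * y - x' ^ 2 * y - 2 * x' ^ 2 + 2) / x' *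
        ((1 - x' ^ 2) ^ (-(1 : ℝ) / 2) *
          (P.derivative.eval (1 - x' ^ 2 * y) * (-(x' ^ 2)))) +
      y * ((n : ℝ) * x' ^ 3 - n * x') * ((1 - x' ^ 2) ^ (-(1 : ℝ) / 2) *
        P.eval (1 - x' ^ 2 * y))) = fun x' : ℝ => (1 - x' ^ 2) ^ (-(1 : ℝ) / 2) *
      (-(y * ((1 - x' ^ 2) * (x' * (1 + (1 - x' ^ 2 * y))))) * P.derivative.eval (1 - x' ^ 2 * y)
        + -(y * n * ((1 - x' ^ 2) * x')) * P.eval (1 - x' ^ 2 * y)) := by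
    funext t
    rcases eq_or_ne t 0 with rfl | ht
    · simp
    · field_simp
      ring
  rw [hev]
  have hG2 := hG.deriv
  refine (congrArg _ hG2).trans ?_
  have e1 := congrArg (Polynomial.eval (1 - x ^ 2 * y))
    (Polynomial.Chebyshev.one_sub_X_sq_mul_derivative_T_eq_poly_in_T (R := ℝ) (n - 1 : ℤ))
  have e3 := congrArg (Polynomial.eval (1 - x ^ 2 * y)) (Polynomial.Chebyshev.T_add_one ℝ (n : ℤ))
  have e2 := congrArg (Polynomial.eval (1 - x ^ 2 * y))
    (Polynomial.Chebyshev.one_sub_X_sq_mul_derivative_derivative_T_eq_poly_in_T (R := ℝ) (n : ℤ))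
  simp [← hP] at e1 e2 e3
  push_cast
  simp only [Function.comp, Pi.add_apply, Pi.mul_apply]
  rw [e3]
  generalize (1 - x ^ 2) ^ (-(1 : ℝ) / 2) = w
  generalize Polynomial.eval (1 - x ^ 2 * y) (Polynomial.derivative (Polynomial.derivative P)) = p2 at *
  generalize Polynomial.eval (1 - x ^ 2 * y) (Polynomial.derivative P) = p1 at *
  generalize Polynomial.eval (1 - x ^ 2 * y) P = p0 at *
  generalize Polynomial.eval (1 - x ^ 2 * y) (Polynomial.Chebyshev.T ℝ (n - 1)) = pm at *
  have hne := hpos.ne'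
  obtain ⟨v, rfl⟩ : ∃ v, w = v * (1 - x ^ 2) := ⟨w / (1 - x ^ 2), by field_simp⟩
  rw [mul_div_cancel_right₀ v hne]
  linear_combination (2 * v * (1 - x ^ 2) * y * (1 - x ^ 2)) * e2
    + (2 * n + 2) * (v * (1 - x ^ 2)) * e1
end

section
/- Let f(n, x, y) = (1-x^2)^{-1/2} * T_n(1 - x^2*y). For every natural number n, every real y, and every real x with |x| < 1, the following three annihilating relations hold: (i) (x^3 - x) * f_x + (2y - 2x^2*y) * f_y + x^2 * f = 0; (ii) n * f(n+1, x, y) + (x^2*y^2 - 2y) * f_y + (n*x^2*y - n) * f = 0; (iii) (x^2*y^2 - 2y) * f_yy + (x^2*y - 1) * f_y - n^2*x^2 * f = 0, where all derivatives are evaluated at (n, x, y). -/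
open Real

theorem chebF_hasDerivAt_y (p : Polynomial ℝ) (c x y : ℝ) :
    HasDerivAt (fun y' => c * p.eval (1 - x ^ 2 * y'))
      (c * (-x ^ 2) * p.derivative.eval (1 - x ^ 2 * y)) y := by
  have h1 : HasDerivAt (fun y' : ℝ => 1 - x ^ 2 * y') (-x ^ 2) y := by
    simpa using ((hasDerivAt_id y).const_mul (x ^ 2)).const_sub 1
  have h2 := ((p.hasDerivAt (1 - x ^ 2 * y)).comp y h1).const_mul c
  exact h2.congr_deriv (by ring)

theorem chebF_hasDerivAt_x (p : Polynomial ℝ) (x y : ℝ) (hx : 0 < 1 - x ^ 2) :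
    HasDerivAt (fun x' => (1 - x' ^ 2) ^ (-(1 : ℝ) / 2) * p.eval (1 - x' ^ 2 * y))
      (x * ((1 - x ^ 2) ^ (-(1 : ℝ) / 2) / (1 - x ^ 2)) * p.eval (1 - x ^ 2 * y) +
        (1 - x ^ 2) ^ (-(1 : ℝ) / 2) * ((-2 * x * y) * p.derivative.eval (1 - x ^ 2 * y))) x := by
  have h0 : HasDerivAt (fun x' : ℝ => x' ^ 2) (2 * x) x := by
    simpa using hasDerivAt_pow 2 x
  have h1 : HasDerivAt (fun x' : ℝ => 1 - x' ^ 2 * y) (-(2 * x * y)) x :=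
    (h0.mul_const y).const_sub 1
  have h2 := (p.hasDerivAt (1 - x ^ 2 * y)).comp x h1
  have h3 := (h0.const_sub 1).rpow_const (p := -(1 : ℝ) / 2) (Or.inl hx.ne')
  refine (h3.mul h2).congr_deriv ?_
  rw [Real.rpow_sub_one hx.ne']
  simp only [Function.comp]
  ring

/-- The Gröbner basis of the annihilating ideal of `f`:
(i) `(x³-x) f_x + (2y-2x²y) f_y + x² f = 0`;
(ii) `n f(n+1) + (x²y²-2y) f_y + (nx²y-n) f = 0`;
(iii) `(x²y²-2y) f_yy + (x²y-1) f_y - n²x² f = 0`. -/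
theorem chebF_annihilator (n : ℕ) (y x : ℝ) (hx : |x| < 1) :
    ((x ^ 3 - x) * deriv (fun x' => chebF n x' y) x +
        (2 * y - 2 * x ^ 2 * y) * deriv (fun y' => chebF n x y') y +
        x ^ 2 * chebF n x y = 0) ∧
      ((n : ℝ) * chebF (n + 1) x y +
        (x ^ 2 * y ^ 2 - 2 * y) * deriv (fun y' => chebF n x y') y +
        ((n : ℝ) * x ^ 2 * y - n) * chebF n x y = 0) ∧
      ((x ^ 2 * y ^ 2 - 2 * y) * deriv (deriv (fun y' => chebF n x y')) y +
        (x ^ 2 * y - 1) * deriv (fun y' => chebF n x y') y -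
        (n : ℝ) ^ 2 * x ^ 2 * chebF n x y = 0) := by
  have hpos : 0 < 1 - x ^ 2 := by
    have := (sq_lt_one_iff_abs_lt_one x).2 hx
    linarith
  have hy : ∀ y, deriv (fun y' => chebF n x y') y = _ := fun y =>
    (chebF_hasDerivAt_y (Polynomial.Chebyshev.T ℝ n) ((1 - x ^ 2) ^ (-(1 : ℝ) / 2)) x y).deriv
  have hyy : deriv (deriv (fun y' => chebF n x y')) y = _ :=
    (congrArg (fun g => deriv g y) (funext hy)).trans
      (chebF_hasDerivAt_y (Polynomial.Chebyshev.T ℝ n).derivative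
        ((1 - x ^ 2) ^ (-(1 : ℝ) / 2) * (-x ^ 2)) x y).deriv
  have hxx : deriv (fun x' => chebF n x' y) x = _ :=
    (chebF_hasDerivAt_x (Polynomial.Chebyshev.T ℝ n) x y hpos).deriv
  have e1 := congrArg (Polynomial.eval (1 - x ^ 2 * y))
    (Polynomial.Chebyshev.one_sub_X_sq_mul_derivative_T_eq_poly_in_T (R := ℝ) ((n : ℤ) - 1))
  have e2 := congrArg (Polynomial.eval (1 - x ^ 2 * y))
    (Polynomial.Chebyshev.one_sub_X_sq_mul_derivative_derivative_T_eq_poly_in_T (R := ℝ) n)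
  have e3 := congrArg (Polynomial.eval (1 - x ^ 2 * y))
    (Polynomial.Chebyshev.T_add_one ℝ n)
  rw [hyy, hy, hxx]
  unfold chebF
  push_cast
  simp at e1 e2 e3
  generalize (1 - x ^ 2) ^ (-(1 : ℝ) / 2) = c at *
  refine ⟨?_, ?_, ?_⟩
  · field_simp
    ring
  · rw [e3]
    linear_combination c * e1
  · linear_combination -c * x ^ 2 * e2
end
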